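/- For every real x ∈ (0,1) and all integers s, t ≥ 0, the function X_{s,t}(x) satisfies the recursion X_{s,t}(x) = 1 + g(x)·R_s(x)·R_t(x)·X_{s,t}(x)·(1 + g(x)·R_{s+1}(x)·R_{t+1}(x)·X_{s+1,t+1}(x)). -/

import Mathlib

/-- The map `g(x) = x(1+x+x²)/(1+4x+x²)²`. -/
noncomputable def gfun (x : ℝ) : ℝ := x * (1 + x + x ^ 2) / (1 + 4 * x + x ^ 2) ^ 2

/-- `R_s(x)`. -/
noncomputable def Rfun (s : ℕ) (x : ℝ) : ℝ :=
  ((1 + 4 * x + x ^ 2) / (1 + x + x ^ 2)) *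
    ((1 - x ^ s) * (1 - x ^ (s + 3))) / ((1 - x ^ (s + 1)) * (1 - x ^ (s + 2)))

/-- `X_{s,t}(x)`. -/
noncomputable def Xfun (s t : ℕ) (x : ℝ) : ℝ :=
  ((1 - x ^ 3) * (1 - x ^ (s + 1)) * (1 - x ^ (t + 1)) * (1 - x ^ (s + t + 3))) /
    ((1 - x) * (1 - x ^ (s + 3)) * (1 - x ^ (t + 3)) * (1 - x ^ (s + t + 1)))

lemma one_sub_pow_ne (x : ℝ) (hx : x ∈ Set.Ioo (0:ℝ) 1) (n : ℕ) : 1 - x ^ (n + 1) ≠ 0 := by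
  have := pow_lt_one₀ hx.1.le hx.2 (Nat.succ_ne_zero n)
  exact (sub_pos.2 this).ne'

/-- The product `g·R_s·R_t·X_{s,t}` telescopes. -/
lemma gRRX (x : ℝ) (hx : x ∈ Set.Ioo (0:ℝ) 1) (s t : ℕ) :
    gfun x * Rfun s x * Rfun t x * Xfun s t x =
      x * (1 - x ^ s) * (1 - x ^ t) * (1 - x ^ (s + t + 3)) /
        ((1 - x ^ (s + 2)) * (1 - x ^ (t + 2)) * (1 - x ^ (s + t + 1))) := by
  have h0 := hx.1
  have hp : 1 + 4 * x + x ^ 2 ≠ 0 := by positivity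
  have hq : 1 + x + x ^ 2 ≠ 0 := by positivity
  have h1 : 1 - x ≠ 0 := (sub_pos.2 hx.2).ne'
  have a1 := one_sub_pow_ne x hx s
  have a2 := one_sub_pow_ne x hx (s + 1)
  have a3 := one_sub_pow_ne x hx (s + 2)
  have b1 := one_sub_pow_ne x hx t
  have b2 := one_sub_pow_ne x hx (t + 1)
  have b3 := one_sub_pow_ne x hx (t + 2)
  have c1 := one_sub_pow_ne x hx (s + t)
  have e : 1 - x ^ 3 = (1 - x) * (1 + x + x ^ 2) := by ring
  simp only [add_assoc, Nat.reduceAdd] at a2 a3 b2 b3 c1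
  unfold gfun Rfun Xfun
  rw [e]
  simp only [add_assoc] at *
  generalize 1 - x ^ (s + 1) = A1 at *
  generalize 1 - x ^ (s + 2) = A2 at *
  generalize 1 - x ^ (s + 3) = A3 at *
  generalize 1 - x ^ (t + 1) = B1 at *
  generalize 1 - x ^ (t + 2) = B2 at *
  generalize 1 - x ^ (t + 3) = B3 at *
  generalize 1 - x ^ (s + (t + 1)) = C1 at *
  generalize 1 - x ^ (s + (t + 3)) = C3 at *
  generalize 1 + (4 * x + x ^ 2) = p at *
  generalize 1 + (x + x ^ 2) = q at *
  field_simp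

/-- For every `x ∈ (0,1)` and all integers `s, t ≥ 0`,
`X_{s,t} = 1 + g·R_s·R_t·X_{s,t}·(1 + g·R_{s+1}·R_{t+1}·X_{s+1,t+1})`. -/
theorem Xfun_recursion (x : ℝ) (hx : x ∈ Set.Ioo (0:ℝ) 1) (s t : ℕ) :
    Xfun s t x = 1 + gfun x * Rfun s x * Rfun t x * Xfun s t x *
      (1 + gfun x * Rfun (s + 1) x * Rfun (t + 1) x * Xfun (s + 1) (t + 1) x) := by
  rw [gRRX x hx, gRRX x hx]
  have h1 : 1 - x ≠ 0 := (sub_pos.2 hx.2).ne'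
  have a2 := one_sub_pow_ne x hx (s + 1)
  have a3 := one_sub_pow_ne x hx (s + 2)
  have b2 := one_sub_pow_ne x hx (t + 1)
  have b3 := one_sub_pow_ne x hx (t + 2)
  have c1 := one_sub_pow_ne x hx (s + t)
  have c3 := one_sub_pow_ne x hx (s + t + 2)
  unfold Xfun
  rw [show s + 1 + (t + 1) + 3 = s + t + 5 by ring, show s + 1 + (t + 1) + 1 = s + t + 3 by ring]
  simp only [add_assoc, Nat.reduceAdd] at *
  simp only [pow_add, pow_one] at *
  generalize x ^ s = a at *
  generalize x ^ t = b at *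
  generalize ha2 : 1 - a * x ^ 2 = A2 at *
  generalize ha3 : 1 - a * x ^ 3 = A3 at *
  generalize hb2 : 1 - b * x ^ 2 = B2 at *
  generalize hb3 : 1 - b * x ^ 3 = B3 at *
  generalize hc1 : 1 - a * (b * x) = C1 at *
  generalize hc3 : 1 - a * (b * x ^ 3) = C3 at *
  generalize h : 1 - x = D at *
  field_simp
  subst ha2 ha3 hb2 hb3 hc1 hc3 h
  ring
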